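/- Every set of three pairwise non-orthogonal pure states on a finite-dimensional complex Hilbert space that is weakly antidistinguishable is necessarily strongly antidistinguishable, and hence antidistinguishable. -/

import Mathlib

open Matrix

/-- Square complex matrices of size `d`, acting on the Hilbert space `ℂ^d`. -/
abbrev Mat (d : ℕ) := Matrix (Fin d) (Fin d) ℂ

/-- An orthogonal projection. -/
def IsProjection {d : ℕ} (p : Mat d) : Prop := p.IsHermitian ∧ p * p = p

/-- A pure state: a rank-1 orthogonal projection `|ψ⟩⟨ψ|` for a unit vector `ψ`. -/
def IsPureState {d : ℕ} (ρ : Mat d) : Prop :=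
  ∃ ψ : Fin d → ℂ, star ψ ⬝ᵥ ψ = 1 ∧ ρ = vecMulVec ψ (star ψ)

/-- A PVM: a finite family of orthogonal projections, pairwise orthogonal, summing to `1`. -/
def IsPVM {d : ℕ} (P : Finset (Mat d)) : Prop :=
  (∀ p ∈ P, IsProjection p) ∧
  (∀ p ∈ P, ∀ q ∈ P, p ≠ q → p * q = 0) ∧
  ∑ p ∈ P, p = 1

/-- A PVM given as an indexed family. -/
def IsPVMFam {d : ℕ} {ι : Type} [Fintype ι] (π : ι → Mat d) : Prop :=
  (∀ i, IsProjection (π i)) ∧ (∀ i j, i ≠ j → π i * π j = 0) ∧ ∑ i, π i = 1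

/-- `P` weakly antidistinguishes `S`: every outcome of `P` excludes some state of `S`. -/
def WeaklyAntidistinguishes {d : ℕ} (P S : Finset (Mat d)) : Prop :=
  ∀ p ∈ P, ∃ ρ ∈ S, (p * ρ).trace = 0

/-- `S` is weakly antidistinguishable. -/
def IsWA {d : ℕ} (S : Finset (Mat d)) : Prop :=
  ∃ P : Finset (Mat d), IsPVM P ∧ WeaklyAntidistinguishes P S

/-- `P` strongly antidistinguishes `S`: it weakly antidistinguishes `S` and for each state
there is an outcome excluding that state and no other. -/
def StronglyAntidistinguishes {d : ℕ} (P S : Finset (Mat d)) : Prop :=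
  WeaklyAntidistinguishes P S ∧
  ∀ ρ ∈ S, ∃ p ∈ P, (p * ρ).trace = 0 ∧ ∀ ρ' ∈ S, ρ' ≠ ρ → (p * ρ').trace ≠ 0

/-- `S` is strongly antidistinguishable. -/
def IsSA {d : ℕ} (S : Finset (Mat d)) : Prop :=
  ∃ P : Finset (Mat d), IsPVM P ∧ StronglyAntidistinguishes P S

/-- `S = {ρ_1, …, ρ_N}` is antidistinguishable: there is a PVM `{π_i}_{i=1}^N`, with one
outcome per state, such that `Tr(π_i ρ_i) = 0` for each `i`. -/
def IsA {d : ℕ} (S : Finset (Mat d)) : Prop :=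
  ∃ π : Mat d → Mat d,
    (∀ ρ ∈ S, IsProjection (π ρ)) ∧
    (∀ ρ ∈ S, ∀ ρ' ∈ S, ρ ≠ ρ' → π ρ * π ρ' = 0) ∧
    (∑ ρ ∈ S, π ρ = 1) ∧
    ∀ ρ ∈ S, (π ρ * ρ).trace = 0

/-- A context: a finite set of rank-1 orthogonal projections, pairwise orthogonal,
summing to the identity. -/
def IsContext {d : ℕ} (C : Finset (Mat d)) : Prop :=
  (∀ p ∈ C, IsPureState p) ∧
  (∀ p ∈ C, ∀ q ∈ C, p ≠ q → p * q = 0) ∧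
  ∑ p ∈ C, p = 1

/-- A `{0,1}`-valued assignment on `X` such that every context drawn from `X`
has exactly one vertex assigned the value `1`. -/
def NoncontextualAssignment {d : ℕ} (X : Finset (Mat d)) (ν : Mat d → ℕ) : Prop :=
  (∀ σ ∈ X, ν σ = 0 ∨ ν σ = 1) ∧
  ∀ C ⊆ X, IsContext C → ∑ σ ∈ C, ν σ = 1

/-- `σ` is an implied projector of `S`: a rank-1 projection orthogonal to some state of `S`. -/
def ImpliedProjector {d : ℕ} (S : Finset (Mat d)) (σ : Mat d) : Prop :=
  IsPureState σ ∧ ∃ ρ ∈ S, ρ * σ = 0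

/-- `X` is a contextuality scenario generated by `S`: a finite set of rank-1 projections
with `S ⊆ X` and `X \ S ⊆ I(S)`. -/
def GeneratedScenario {d : ℕ} (S X : Finset (Mat d)) : Prop :=
  (∀ σ ∈ X, IsPureState σ) ∧ S ⊆ X ∧ ∀ σ ∈ X, σ ∉ S → ImpliedProjector S σ

/-- `S` is a contextual instance of the scenario `X`: there is no noncontextual value
assignment on `X` assigning `1` to every state of `S`. -/
def ContextualInstance {d : ℕ} (S X : Finset (Mat d)) : Prop :=
  ¬ ∃ ν : Mat d → ℕ, NoncontextualAssignment X ν ∧ ∀ ρ ∈ S, ν ρ = 1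

/-- `S` is contextual: some scenario generated by `S` has `S` as a contextual instance. -/
def IsContextualSet {d : ℕ} (S : Finset (Mat d)) : Prop :=
  ∃ X : Finset (Mat d), GeneratedScenario S X ∧ ContextualInstance S X

/-- `S` is non-orthogonal: distinct states have nonzero overlap. -/
def NonOrthogonal {d : ℕ} (S : Finset (Mat d)) : Prop :=
  ∀ ρ ∈ S, ∀ ρ' ∈ S, ρ ≠ ρ' → (ρ * ρ').trace ≠ 0

/-- `S` is maximally contextual: `S` is contextual and no proper subset of `S` is. -/
def MaximallyContextual {d : ℕ} (S : Finset (Mat d)) : Prop :=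
  IsContextualSet S ∧ ∀ S' ⊂ S, ¬ IsContextualSet S'

theorem IsPureState.isProjection {d : ℕ} {ρ : Mat d} (h : IsPureState ρ) : IsProjection ρ := by
  obtain ⟨ψ, hψ, rfl⟩ := h
  refine ⟨?_, ?_⟩
  · simp [Matrix.IsHermitian, conjTranspose_vecMulVec]
  · rw [vecMulVec_mul_vecMulVec, hψ, one_smul]

open scoped ComplexOrder in
theorem IsProjection.mul_eq_zero_of_trace_eq_zero {d : ℕ} {p ρ : Mat d} (hp : IsProjection p)
    (hρ : IsProjection ρ) (h : (p * ρ).trace = 0) : p * ρ = 0 := by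
  rw [← trace_conjTranspose_mul_self_eq_zero_iff, conjTranspose_mul, hp.1.eq, hρ.1.eq,
    mul_assoc, ← mul_assoc p p, hp.2, trace_mul_comm, mul_assoc, hρ.2, h]

theorem IsProjection.mul_eq_zero_comm {d : ℕ} {p q : Mat d} (hp : IsProjection p)
    (hq : IsProjection q) (h : p * q = 0) : q * p = 0 := by
  simpa [hp.1.eq, hq.1.eq] using congrArg conjTranspose h

theorem sum_mul_sum_eq_sum_inter {d : ℕ} {P A B : Finset (Mat d)} (hP : IsPVM P)
    (hA : A ⊆ P) (hB : B ⊆ P) :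
    (∑ p ∈ A, p) * ∑ q ∈ B, q = ∑ p ∈ A ∩ B, p := by
  classical
  rw [Finset.sum_mul, ← Finset.filter_mem_eq_inter, Finset.sum_filter]
  refine Finset.sum_congr rfl fun p hp => ?_
  rw [Finset.mul_sum]
  split_ifs with hpB
  · rw [Finset.sum_eq_single_of_mem p hpB
      fun q hq hqp => hP.2.1 p (hA hp) q (hB hq) hqp.symm]
    exact (hP.1 p (hA hp)).2
  · refine Finset.sum_eq_zero fun q hq => hP.2.1 p (hA hp) q (hB hq) ?_
    rintro rfl
    exact hpB hq

/-- Weak antidistinguishability implies antidistinguishability: group the outcomes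
according to a state they exclude. -/
theorem IsWA.isA {d : ℕ} {S : Finset (Mat d)} (h : IsWA S) : IsA S := by
  classical
  obtain ⟨P, hP, hPS⟩ := h
  choose! f hfS hf using hPS
  refine ⟨fun ρ => ∑ p ∈ P with f p = ρ, p, fun ρ _ => ⟨?_, ?_⟩, fun ρ _ ρ' _ hne => ?_, ?_,
    fun ρ _ => ?_⟩
  · rw [Matrix.IsHermitian, conjTranspose_sum]
    exact Finset.sum_congr rfl fun p hp => (hP.1 p (Finset.mem_filter.1 hp).1).1
  · rw [sum_mul_sum_eq_sum_inter hP (Finset.filter_subset _ _) (Finset.filter_subset _ _),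
      Finset.inter_self]
  · rw [sum_mul_sum_eq_sum_inter hP (Finset.filter_subset _ _) (Finset.filter_subset _ _)]
    refine Finset.sum_eq_zero fun p hp => absurd ?_ hne
    simp only [Finset.mem_inter, Finset.mem_filter] at hp
    exact hp.1.2.symm.trans hp.2.2
  · rw [Finset.sum_fiberwise_of_maps_to hfS]
    exact hP.2.2
  · rw [Finset.sum_mul, trace_sum]
    refine Finset.sum_eq_zero fun p hp => ?_
    obtain ⟨hpP, rfl⟩ := Finset.mem_filter.1 hp
    exact hf p hpP

/-- Every set of three pairwise non-orthogonal pure states that is weakly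
antidistinguishable is necessarily strongly antidistinguishable, hence
antidistinguishable. -/
theorem statement_5 {d : ℕ} (S : Finset (Mat d)) (hcard : S.card = 3)
    (hpure : ∀ ρ ∈ S, IsPureState ρ) (hnon : NonOrthogonal S)
    (hWA : IsWA S) :
    IsSA S ∧ IsA S := by
  classical
  refine ⟨?_, hWA.isA⟩
  obtain ⟨π, hproj, horth, hsum, hexcl⟩ := hWA.isA
  have hzero : ∀ ρ ∈ S, ∀ ρ' ∈ S, (π ρ * ρ').trace = 0 → π ρ * ρ' = 0 := fun ρ hρ ρ' hρ' =>
    (hproj ρ hρ).mul_eq_zero_of_trace_eq_zero (hpure ρ' hρ').isProjection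
  have honly : ∀ ρ ∈ S, ∀ ρ' ∈ S, ρ' ≠ ρ → (π ρ * ρ').trace ≠ 0 := by
    intro ρ hρ ρ' hρ' hne h
    have hρ'mem : ρ' ∈ S.erase ρ := Finset.mem_erase.2 ⟨hne, hρ'⟩
    obtain ⟨σ, hσ⟩ : ∃ σ, (S.erase ρ).erase ρ' = {σ} := by
      rw [← Finset.card_eq_one, Finset.card_erase_of_mem hρ'mem, Finset.card_erase_of_mem hρ,
        hcard]
    have hσmem : σ ∈ (S.erase ρ).erase ρ' := hσ ▸ Finset.mem_singleton_self σ
    simp only [Finset.mem_erase] at hσmem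
    obtain ⟨hσρ', -, hσS⟩ := hσmem
    rw [← Finset.add_sum_erase S π hρ, ← Finset.add_sum_erase _ π hρ'mem, hσ,
      Finset.sum_singleton] at hsum
    have hfix : π σ * ρ' = ρ' := by
      simpa [add_mul, hzero ρ hρ ρ' hρ' h, hzero ρ' hρ' ρ' hρ' (hexcl ρ' hρ')]
        using congrArg (· * ρ') hsum
    have hσπ : σ * π σ = 0 := (hproj σ hσS).mul_eq_zero_comm (hpure σ hσS).isProjection
      (hzero σ hσS σ hσS (hexcl σ hσS))
    apply hnon σ hσS ρ' hρ' hσρ'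
    rw [← hfix, ← mul_assoc, hσπ, zero_mul, trace_zero]
  have hinj : Set.InjOn π S := by
    intro ρ hρ ρ' hρ' heq
    by_contra hne
    exact honly ρ hρ ρ' hρ' (Ne.symm hne) (heq ▸ hexcl ρ' hρ')
  refine ⟨S.image π, ⟨?_, ?_, ?_⟩, ?_, fun ρ hρ =>
    ⟨π ρ, Finset.mem_image_of_mem π hρ, hexcl ρ hρ, honly ρ hρ⟩⟩
  · simpa only [Finset.forall_mem_image] using hproj
  · simp only [Finset.forall_mem_image]
    intro ρ hρ ρ' hρ' hne
    exact horth ρ hρ ρ' hρ' (ne_of_apply_ne π hne)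
  · rw [Finset.sum_image hinj, hsum]
  · simp only [WeaklyAntidistinguishes, Finset.forall_mem_image]
    exact fun ρ hρ => ⟨ρ, hρ, hexcl ρ hρ⟩
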